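/- Let X be a spectral space. Then X itself is an element of 𝒳(X) and is the unique maximal point of 𝒳(X): for every Y ∈ 𝒳(X), the point X belongs to the closure of {Y} in 𝒳(X), and X is the only element of 𝒳(X) with this property (equivalently, X is the unique closed point of 𝒳(X)). -/

import Mathlib

open Set TopologicalSpace Topology

/-- A subset of a topological space is *inverse-closed* if it is an intersection of a
family of quasi-compact open subsets. -/
def InvClosed {X : Type*} [TopologicalSpace X] (Y : Set X) : Prop :=
  ∃ 𝒪 : Set (Set X), (∀ U ∈ 𝒪, IsOpen U ∧ IsCompact U) ∧ Y = ⋂₀ 𝒪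

/-- A subset is *saturated* if it is an intersection of open sets. -/
def IsSatd {X : Type*} [TopologicalSpace X] (Y : Set X) : Prop :=
  ∃ 𝒪 : Set (Set X), (∀ U ∈ 𝒪, IsOpen U) ∧ Y = ⋂₀ 𝒪

/-- A topological space is *spectral* if it is T0, quasi-compact, sober, and the
quasi-compact open subsets form a basis closed under finite intersections. -/
def IsSpectralSpace (X : Type*) [TopologicalSpace X] : Prop :=
  T0Space X ∧ CompactSpace X ∧ QuasiSober X ∧
    IsTopologicalBasis {U : Set X | IsOpen U ∧ IsCompact U} ∧
    ∀ U V : Set X, IsOpen U → IsCompact U → IsOpen V → IsCompact V → IsCompact (U ∩ V)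

/-- `𝒳(X)`: the nonempty inverse-closed subsets of `X`. -/
abbrev XCal (X : Type*) [TopologicalSpace X] : Type _ :=
  {Y : Set X // Y.Nonempty ∧ InvClosed Y}

/-- The Zariski topology on `𝒳(X)`, with basic open sets `𝒰(Ω) = {Y : Y ⊆ Ω}` for `Ω`
quasi-compact open in `X`. -/
instance XCal.instTop (X : Type*) [TopologicalSpace X] : TopologicalSpace (XCal X) :=
  generateFrom {S : Set (XCal X) | ∃ Ω : Set X, IsOpen Ω ∧ IsCompact Ω ∧
    S = {Y : XCal X | (Y : Set X) ⊆ Ω}}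

/-- The specialization-type order: `x ≤ y` iff `y ∈ closure {x}`. -/
def spord {X : Type*} [TopologicalSpace X] (x y : X) : Prop := y ∈ closure {x}

/-- Closure under generizations of a set `S`: all points `z ≤ s` for some `s ∈ S`. -/
def genOf {X : Type*} [TopologicalSpace X] (S : Set X) : Set X :=
  {z : X | ∃ s ∈ S, spord z s}

/-- A map is *spectral* if preimages of quasi-compact open sets are quasi-compact open. -/
def SpecMap {X Y : Type*} [TopologicalSpace X] [TopologicalSpace Y] (f : X → Y) : Prop :=
  ∀ Ω : Set Y, IsOpen Ω → IsCompact Ω → IsOpen (f ⁻¹' Ω) ∧ IsCompact (f ⁻¹' Ω)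

/-- The constructible topology on a spectral space: generated by the quasi-compact open
sets together with their complements. -/
def constructibleTop (X : Type*) [TopologicalSpace X] : TopologicalSpace X :=
  generateFrom ({U : Set X | IsOpen U ∧ IsCompact U} ∪
    {S : Set X | ∃ U : Set X, IsOpen U ∧ IsCompact U ∧ S = Uᶜ})

/-- `s` is the supremum of `S` for the order induced by the topology. -/
def IsSupOf {X : Type*} [TopologicalSpace X] (S : Set X) (s : X) : Prop :=
  (∀ c ∈ S, spord c s) ∧ ∀ t : X, (∀ c ∈ S, spord c t) → spord s t

/-- A map is sup-preserving if it sends existing finite suprema to suprema. -/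
def SupPreserving {X Y : Type*} [TopologicalSpace X] [TopologicalSpace Y] (f : X → Y) : Prop :=
  ∀ F : Set X, F.Finite → ∀ s : X, IsSupOf F s → IsSupOf (f '' F) (f s)

/-- A map is open onto its image. -/
def OpenOntoImage {X Y : Type*} [TopologicalSpace X] [TopologicalSpace Y] (f : X → Y) : Prop :=
  ∀ V : Set X, IsOpen V → ∃ W : Set Y, IsOpen W ∧ f '' V = W ∩ Set.range f

/-- `Z` lies in the closure of `{Y}` exactly when every quasi-compact open set containing `Z`
contains `Y`. -/
theorem XCal.mem_closure_singleton_iff {X : Type*} [TopologicalSpace X] {Y Z : XCal X} :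
    Z ∈ closure ({Y} : Set (XCal X)) ↔
      ∀ Ω : Set X, IsOpen Ω → IsCompact Ω → (Z : Set X) ⊆ Ω → (Y : Set X) ⊆ Ω := by
  rw [← specializes_iff_mem_closure]
  constructor
  · intro h Ω ho hc hZ
    exact h.mem_open (isOpen_generateFrom_of_mem ⟨Ω, ho, hc, rfl⟩ :
      IsOpen {W : XCal X | (W : Set X) ⊆ Ω}) hZ
  · intro h
    rw [Specializes, nhds_generateFrom, nhds_generateFrom]
    refine le_iInf₂ fun S hS => ?_
    obtain ⟨hZ, Ω, ho, hc, rfl⟩ := hS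
    exact iInf₂_le _ ⟨h Ω ho hc hZ, Ω, ho, hc, rfl⟩

/-- For a (nonempty) spectral space `X`, the whole space `X` is an
element of `𝒳(X)` and is its unique maximal point: it lies in the closure of every
singleton `{Y}`, and it is the only element of `𝒳(X)` with this property. -/
theorem stmt8 {X : Type*} [TopologicalSpace X] [Nonempty X] (hX : IsSpectralSpace X) :
    ∃ T : XCal X, (T : Set X) = Set.univ ∧
      (∀ Y : XCal X, T ∈ closure ({Y} : Set (XCal X))) ∧
      (∀ Z : XCal X, (∀ Y : XCal X, Z ∈ closure ({Y} : Set (XCal X))) → Z = T) := by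
  have : CompactSpace X := hX.2.1
  let T : XCal X := ⟨univ, univ_nonempty, {univ}, by simp [isCompact_univ], by simp⟩
  refine ⟨T, rfl, fun Y => ?_, fun Z hZ => Subtype.ext (univ_subset_iff.mp ?_)⟩
  · exact XCal.mem_closure_singleton_iff.mpr fun Ω _ _ h => (subset_univ _).trans h
  · obtain ⟨𝒪, h𝒪, hZ𝒪⟩ := Z.2.2
    rw [hZ𝒪]
    refine subset_sInter fun U hU => ?_
    exact XCal.mem_closure_singleton_iff.mp (hZ T) U (h𝒪 U hU).1 (h𝒪 U hU).2
      (hZ𝒪 ▸ sInter_subset_of_mem hU)
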